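/- Let β = √(2/3), let a ∈ ℝ, and for T ∈ ℝ define P_T(φ) = e^{2βφ}·(2(φ − a)/β + (φ − a)² + 2T). Then there exists φ with P_T′(φ) = 0 and P_T″(φ) = 0 if and only if T = 15/16; in that case the critical point is φ = a − 3/(2β). (For general β ≠ 0 the critical temperature is T_c = 5/(8β²).) -/

import Mathlib

/-- The derivative of an exponential times a function. -/
theorem HasDerivAt.exp_const_mul_mul {c x q' : ℝ} {q : ℝ → ℝ} (hq : HasDerivAt q q' x) :
    HasDerivAt (fun y => Real.exp (c * y) * q y) (Real.exp (c * x) * (c * q x + q')) x := by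
  have h := (((hasDerivAt_id x).const_mul c).exp).mul hq
  refine h.congr_deriv ?_
  simp only [id_eq, mul_one]
  ring

/-- For any `β ≠ 0`, the effective pressure is critical exactly at `φ = a - 3 / (2 * β)`
and `T = 5 / (8 * β ^ 2)`. -/
theorem effectivePressure_critical_iff {β : ℝ} (hβ : β ≠ 0) (a T φ : ℝ) :
    let p : ℝ → ℝ := fun y =>
      Real.exp (2 * β * y) * (2 * (y - a) / β + (y - a) ^ 2 + 2 * T)
    (deriv p φ = 0 ∧ deriv (deriv p) φ = 0) ↔
      φ = a - 3 / (2 * β) ∧ T = 5 / (8 * β ^ 2) := by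
  intro p
  let r : ℝ → ℝ := fun y => 2 * β * (y - a) ^ 2 + 6 * (y - a) + (4 * β * T + 2 / β)
  have hp : deriv p = fun y => Real.exp (2 * β * y) * r y := by
    funext y
    have hx : HasDerivAt (fun y : ℝ => y - a) 1 y := (hasDerivAt_id y).sub_const a
    have hq : HasDerivAt (fun y => 2 * (y - a) / β + (y - a) ^ 2 + 2 * T)
        (2 * 1 / β + 2 * (y - a)) y := by
      simpa using (((hx.const_mul 2).div_const β).add (hx.pow 2)).add_const (2 * T)
    rw [hq.exp_const_mul_mul.deriv]
    simp only [r]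
    field_simp
    ring
  have hr : HasDerivAt r (4 * β * (φ - a) + 6) φ := by
    have hx : HasDerivAt (fun y : ℝ => y - a) 1 φ := (hasDerivAt_id φ).sub_const a
    refine ((((hx.pow 2).const_mul (2 * β)).add (hx.const_mul 6)).add_const
      (4 * β * T + 2 / β)).congr_deriv ?_
    norm_num
    ring
  rw [hp, hr.exp_const_mul_mul.deriv]
  simp only [mul_eq_zero, Real.exp_ne_zero, false_or]
  constructor
  · rintro ⟨h₁, h₂⟩
    rw [h₁, mul_zero, zero_add] at h₂
    have hφ : φ = a - 3 / (2 * β) := by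
      field_simp
      linarith
    refine ⟨hφ, ?_⟩
    simp only [r, hφ] at h₁
    field_simp at h₁ ⊢
    linarith
  · rintro ⟨rfl, rfl⟩
    have h₁ : r (a - 3 / (2 * β)) = 0 := by
      simp only [r]
      field_simp
      ring
    refine ⟨h₁, ?_⟩
    rw [h₁]
    field_simp
    ring

/-- For `β = √(2/3)` and the effective pressure
`P_T(φ) = e^{2βφ}(2(φ−a)/β + (φ−a)² + 2T)`, there is a point `φ` with
`P_T'(φ) = 0 = P_T″(φ)` iff `T = 15/16` (the critical temperature), in which case
the critical point is `φ = a − 3/(2β)`. -/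
theorem stmt_16 (β a : ℝ) (hβ : β = Real.sqrt (2 / 3))
    (P : ℝ → ℝ → ℝ)
    (hP : P = fun T φ => Real.exp (2 * β * φ) *
      (2 * (φ - a) / β + (φ - a) ^ 2 + 2 * T)) :
    ∀ T : ℝ,
      ((∃ φ, deriv (P T) φ = 0 ∧ deriv (deriv (P T)) φ = 0) ↔ T = 15 / 16) ∧
      (T = 15 / 16 → deriv (P T) (a - 3 / (2 * β)) = 0 ∧
        deriv (deriv (P T)) (a - 3 / (2 * β)) = 0) := by
  subst hP
  intro T
  have hβ₀ : β ≠ 0 := by rw [hβ]; positivity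
  have hT : 5 / (8 * β ^ 2) = 15 / 16 := by
    rw [hβ, Real.sq_sqrt (by norm_num)]
    norm_num
  have key := effectivePressure_critical_iff hβ₀ a T
  simp only [hT] at key
  exact ⟨⟨fun ⟨φ, h⟩ => ((key φ).1 h).2, fun h => ⟨_, (key _).2 ⟨rfl, h⟩⟩⟩,
    fun h => (key _).2 ⟨rfl, h⟩⟩
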